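/- arXiv:1304.4813 — 2 statements merged into one kernel-verified Lean document; each statement's English description precedes it below -/
import Mathlib

section
/- Let μ_n = (Σ_{π ∈ Π_n} ov(π))/B_n be the average number of overlappings in a random set partition of [n]. Then there exists a function ε : ℕ → ℝ with ε(n) → 0 as n → ∞ such that for all sufficiently large n, μ_n = (1/4)·(n/log n)²·(1 + 2·(log log n/log n)·(1 + ε(n))). -/
open scoped Classical

def seg (n : ℕ) : Finset ℕ := Finset.Icc 1 n

def IsPartition (P : Finset (Finset ℕ)) (S : Finset ℕ) : Prop :=
  ∅ ∉ P ∧ (∀ B ∈ P, ∀ C ∈ P, B ≠ C → Disjoint B C) ∧ P.biUnion id = S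

noncomputable def partitions (n : ℕ) : Finset (Finset (Finset ℕ)) :=
  ((seg n).powerset.powerset).filter fun P => IsPartition P (seg n)

noncomputable def partitionsK (n k : ℕ) : Finset (Finset (Finset ℕ)) :=
  (partitions n).filter fun P => P.card = k

noncomputable def bell (n : ℕ) : ℕ := (partitions n).card

noncomputable def stirling (n k : ℕ) : ℕ := (partitionsK n k).card

/-- `(i, j)` is an edge of the set partition `P`. -/
def IsEdge (P : Finset (Finset ℕ)) (i j : ℕ) : Prop :=
  i < j ∧ ∃ B ∈ P, i ∈ B ∧ j ∈ B ∧ ∀ p ∈ B, ¬(i < p ∧ p < j)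

/-- `crol P`: number of linear crossings. -/
noncomputable def crol (P : Finset (Finset ℕ)) : ℕ :=
  Nat.card {e : (ℕ × ℕ) × ℕ × ℕ //
    IsEdge P e.1.1 e.1.2 ∧ IsEdge P e.2.1 e.2.2 ∧
      e.1.1 < e.2.1 ∧ e.2.1 < e.1.2 ∧ e.1.2 < e.2.2}

/-- `(i, j)` is a circular edge of `P`. -/
def IsCircEdge (P : Finset (Finset ℕ)) (i j : ℕ) : Prop :=
  IsEdge P i j ∨
    ∃ B ∈ P, ∃ h : B.Nonempty, 2 ≤ B.card ∧ i = B.min' h ∧ j = B.max' h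

/-- `croc P`: number of circular crossings. -/
noncomputable def croc (P : Finset (Finset ℕ)) : ℕ :=
  Nat.card {e : (ℕ × ℕ) × ℕ × ℕ //
    IsCircEdge P e.1.1 e.1.2 ∧ IsCircEdge P e.2.1 e.2.2 ∧
      e.1.1 < e.2.1 ∧ e.2.1 < e.1.2 ∧ e.1.2 < e.2.2}

/-- Two blocks overlap: `min B < min B' < max B < max B'`. -/
def Overlap (B B' : Finset ℕ) : Prop :=
  ∃ (h : B.Nonempty) (h' : B'.Nonempty),
    B.min' h < B'.min' h' ∧ B'.min' h' < B.max' h ∧ B.max' h < B'.max' h'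

/-- `ov P`: number of (unordered) pairs of blocks of `P` that overlap. -/
noncomputable def ov (P : Finset (Finset ℕ)) : ℕ :=
  Nat.card {p : Finset ℕ × Finset ℕ // p.1 ∈ P ∧ p.2 ∈ P ∧ Overlap p.1 p.2}

/-- Two blocks embrace: `min B < min B' ≤ max B' < max B`. -/
def Embrace (B B' : Finset ℕ) : Prop :=
  ∃ (h : B.Nonempty) (h' : B'.Nonempty),
    B.min' h < B'.min' h' ∧ B'.min' h' ≤ B'.max' h' ∧ B'.max' h' < B.max' h

noncomputable def emb (P : Finset (Finset ℕ)) : ℕ :=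
  Nat.card {p : Finset ℕ × Finset ℕ // p.1 ∈ P ∧ p.2 ∈ P ∧ Embrace p.1 p.2}

/-- The block of `P` containing `i`. -/
noncomputable def blockOf (P : Finset (Finset ℕ)) (i : ℕ) : Finset ℕ :=
  (P.filter fun B => i ∈ B).biUnion id

/-- The restricted growth function of `P`: `rgf P i = j` iff `i` lies in the `j`-th
block of `P`, the blocks being ordered by increasing minima. -/
noncomputable def rgf (P : Finset (Finset ℕ)) (i : ℕ) : ℕ :=
  (P.filter fun B => B.min ≤ (blockOf P i).min).card

/-- A 2-pattern: a word on `{1,2}` containing both letters. -/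
def TwoPattern {r : ℕ} (σ : Fin r → ℕ) : Prop :=
  (∀ t, σ t = 1 ∨ σ t = 2) ∧ (∃ t, σ t = 1) ∧ (∃ t, σ t = 2)

/-- `occ n σ P`: number of occurrences of the 2-pattern `σ` in the partition `P` of `[n]`. -/
noncomputable def occ (n : ℕ) {r : ℕ} (σ : Fin r → ℕ) (P : Finset (Finset ℕ)) : ℕ :=
  Nat.card {i : Fin r → ℕ // StrictMono i ∧ (∀ t, i t ∈ seg n) ∧
    ∃ a b : ℕ, a < b ∧
      ∀ t, (σ t = 1 → rgf P (i t) = a) ∧ (σ t = 2 → rgf P (i t) = b)}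

/-- Carlitz `q`-Stirling polynomials. -/
noncomputable def qS : ℕ → ℕ → Polynomial ℚ
  | 0, 0 => 1
  | 0, _ + 1 => 0
  | _ + 1, 0 => 0
  | n + 1, k + 1 =>
      Polynomial.X ^ k * qS n k +
        (∑ i ∈ Finset.range (k + 1), Polynomial.X ^ i) * qS n (k + 1)

/-- Standardization: the order preserving bijection `S → [|S|]`. -/
def stdMap (S : Finset ℕ) (a : ℕ) : ℕ := (S.filter fun x => x ≤ a).card

/-- The standardized 2-block partition obtained from two blocks `A, B`. -/
def stdPair (A B : Finset ℕ) : Finset (Finset ℕ) :=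
  {A.image (stdMap (A ∪ B)), B.image (stdMap (A ∪ B))}

theorem isPartition_iff {P : Finset (Finset ℕ)} {S : Finset ℕ} :
    IsPartition P S ↔ (∀ B ∈ P, B.Nonempty) ∧
      (∀ B ∈ P, ∀ C ∈ P, ∀ x ∈ B, x ∈ C → B = C) ∧ ∀ x, x ∈ S ↔ ∃ B ∈ P, x ∈ B := by
  unfold IsPartition
  refine and_congr ?_ (and_congr ?_ ?_)
  · constructor
    · intro h B hB
      rw [Finset.nonempty_iff_ne_empty]
      rintro rfl
      exact h hB
    · intro h hB
      simpa using h _ hB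
  · refine forall₂_congr fun B _ => forall₂_congr fun C _ => ?_
    constructor
    · intro h x hxB hxC
      by_contra hne
      exact Finset.disjoint_left.1 (h hne) hxB hxC
    · intro h hne
      exact Finset.disjoint_left.2 fun x hxB hxC => hne (h x hxB hxC)
  · rw [Finset.ext_iff]
    refine forall_congr' fun x => ?_
    rw [Finset.mem_biUnion]
    exact iff_comm

/-- The finite set of all partitions of `S`. -/
noncomputable def setPartitions (S : Finset ℕ) : Finset (Finset (Finset ℕ)) :=
  S.powerset.powerset.filter fun P => IsPartition P S

theorem mem_setPartitions {P : Finset (Finset ℕ)} {S : Finset ℕ} :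
    P ∈ setPartitions S ↔ IsPartition P S := by
  simp only [setPartitions, Finset.mem_filter, Finset.mem_powerset, and_iff_right_iff_imp]
  intro h B hB
  rw [Finset.mem_powerset]
  intro x hx
  exact ((isPartition_iff.1 h).2.2 x).2 ⟨B, hB, hx⟩

theorem mem_partitions {P : Finset (Finset ℕ)} {n : ℕ} :
    P ∈ partitions n ↔ IsPartition P (seg n) :=
  mem_setPartitions

/-- Partitions of `S` extending a partition of `U ⊆ S` correspond to partitions of `S \ U`. -/
theorem card_filter_subset {F : Finset (Finset ℕ)} {S U : Finset ℕ} (hF : IsPartition F U)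
    (hU : U ⊆ S) :
    ((setPartitions S).filter fun P => F ⊆ P).card = (setPartitions (S \ U)).card := by
  rw [isPartition_iff] at hF
  obtain ⟨hF1, hF2, hF3⟩ := hF
  refine Finset.card_nbij' (fun P => P \ F) (fun Q => Q ∪ F) ?_ ?_ ?_ ?_
  · intro P hP
    simp only [Finset.coe_filter, mem_setPartitions, isPartition_iff, Set.mem_ofPred_eq,
      SetLike.mem_coe, Finset.mem_sdiff] at hP ⊢
    obtain ⟨⟨h1, h2, h3⟩, h4⟩ := hP
    refine ⟨by grind, by grind, fun x => ?_⟩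
    constructor
    · grind
    · rintro ⟨B, ⟨hB, hBF⟩, hx⟩
      refine ⟨by grind, fun hxU => ?_⟩
      obtain ⟨C, hC, hxC⟩ := (hF3 x).1 hxU
      have := h2 B hB C (h4 hC) x hx hxC
      grind
  · intro Q hQ
    simp only [Finset.coe_filter, mem_setPartitions, isPartition_iff, Set.mem_ofPred_eq,
      SetLike.mem_coe, Finset.mem_sdiff, Finset.mem_union] at hQ ⊢
    obtain ⟨h1, h2, h3⟩ := hQ
    refine ⟨⟨by grind, ?_, fun x => ?_⟩, by grind⟩
    · rintro B (hB | hB) C (hC | hC) x hxB hxC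
      · exact h2 B hB C hC x hxB hxC
      · exact absurd ((hF3 x).2 ⟨C, hC, hxC⟩) ((h3 x).2 ⟨B, hB, hxB⟩).2
      · exact absurd ((hF3 x).2 ⟨B, hB, hxB⟩) ((h3 x).2 ⟨C, hC, hxC⟩).2
      · exact hF2 B hB C hC x hxB hxC
    · have := h3 x
      have := hF3 x
      have := @hU x
      grind
  · intro P hP
    simp only [Finset.coe_filter, Set.mem_ofPred_eq] at hP
    exact Finset.sdiff_union_of_subset hP.2
  · intro Q hQ
    simp only [mem_setPartitions, isPartition_iff, SetLike.mem_coe, Finset.mem_sdiff] at hQ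
    obtain ⟨h1, h2, h3⟩ := hQ
    refine Finset.union_sdiff_cancel_right (Finset.disjoint_left.2 fun B hB hBF => ?_)
    obtain ⟨x, hx⟩ := h1 B hB
    exact ((h3 x).2 ⟨B, hB, hx⟩).2 ((hF3 x).2 ⟨B, hBF, hx⟩)

theorem seg_succ (n : ℕ) : seg (n + 1) = insert (n + 1) (seg n) := by
  ext x
  simp only [seg, Finset.mem_Icc, Finset.mem_insert]
  omega

theorem not_mem_seg (n : ℕ) : n + 1 ∉ seg n := by
  simp [seg]

theorem sum_partitions_singleton_mem (n : ℕ) (f : ℕ → ℝ) :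
    ∑ P ∈ (partitions (n + 1)).filter (fun P => {n + 1} ∈ P), f P.card =
      ∑ P ∈ partitions n, f (P.card + 1) := by
  have hn := not_mem_seg n
  refine Finset.sum_nbij' (fun P => P.erase {n + 1}) (fun P => insert {n + 1} P) ?_ ?_ ?_ ?_ ?_
  · intro P hP
    simp only [Finset.mem_filter, mem_partitions, isPartition_iff, seg_succ, Finset.mem_insert,
      Finset.mem_erase] at hP ⊢
    obtain ⟨⟨h1, h2, h3⟩, h4⟩ := hP
    refine ⟨by grind, by grind, fun x => ?_⟩
    constructor
    · intro hx
      obtain ⟨B, hB, hxB⟩ := (h3 x).1 (Or.inr hx)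
      refine ⟨B, ⟨?_, hB⟩, hxB⟩
      rintro rfl
      rw [Finset.mem_singleton] at hxB
      exact hn (hxB ▸ hx)
    · rintro ⟨B, ⟨hne, hB⟩, hxB⟩
      rcases (h3 x).2 ⟨B, hB, hxB⟩ with rfl | hx
      · exact absurd (h2 B hB _ h4 _ hxB (Finset.mem_singleton_self _)) hne
      · exact hx
  · intro P hP
    simp only [Finset.mem_filter, mem_partitions, isPartition_iff, seg_succ,
      Finset.mem_insert] at hP ⊢
    obtain ⟨h1, h2, h3⟩ := hP
    refine ⟨⟨?_, ?_, fun x => ?_⟩, by simp⟩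
    · rintro B (rfl | hB)
      · simp
      · exact h1 B hB
    · rintro B (rfl | hB) C (rfl | hC) x hxB hxC
      · rfl
      · grind
      · grind
      · exact h2 B hB C hC x hxB hxC
    · rw [h3]
      simp
  · intro P hP
    exact Finset.insert_erase (Finset.mem_filter.1 hP).2
  · intro P hP
    refine Finset.erase_insert fun h => hn ?_
    rw [mem_partitions, isPartition_iff] at hP
    exact (hP.2.2 _).2 ⟨_, h, Finset.mem_singleton_self _⟩
  · intro P hP
    rw [Finset.card_erase_add_one (Finset.mem_filter.1 hP).2]

theorem blockOf_eq {P : Finset (Finset ℕ)} {S B : Finset ℕ} {x : ℕ} (hP : IsPartition P S)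
    (hB : B ∈ P) (hx : x ∈ B) : blockOf P x = B := by
  rw [isPartition_iff] at hP
  have : P.filter (fun C => x ∈ C) = {B} := by
    ext C
    simp only [Finset.mem_filter, Finset.mem_singleton]
    constructor
    · rintro ⟨hC, hxC⟩
      exact hP.2.1 C hC B hB x hxC hx
    · rintro rfl
      exact ⟨hB, hx⟩
  rw [blockOf, this]
  simp

theorem blockOf_mem {P : Finset (Finset ℕ)} {S : Finset ℕ} {x : ℕ} (hP : IsPartition P S)
    (hx : x ∈ S) : blockOf P x ∈ P ∧ x ∈ blockOf P x := by
  obtain ⟨B, hB, hxB⟩ := ((isPartition_iff.1 hP).2.2 x).1 hx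
  rw [blockOf_eq hP hB hxB]
  exact ⟨hB, hxB⟩

theorem erase_notMem_erase {P : Finset (Finset ℕ)} {S B : Finset ℕ} {a : ℕ}
    (hP : IsPartition P S) (hB : B ∈ P) : B.erase a ∉ P.erase B := by
  rw [isPartition_iff] at hP
  intro h
  obtain ⟨hne, h⟩ := Finset.mem_erase.1 h
  obtain ⟨x, hx⟩ := hP.1 _ h
  exact hne (hP.2.1 _ h _ hB x hx (Finset.mem_of_mem_erase hx))

theorem isPartition_insert_into {P : Finset (Finset ℕ)} {S B : Finset ℕ} {a : ℕ}
    (hP : IsPartition P S) (ha : a ∉ S) (hB : B ∈ P) :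
    IsPartition (insert (insert a B) (P.erase B)) (insert a S) := by
  rw [isPartition_iff] at hP ⊢
  obtain ⟨h1, h2, h3⟩ := hP
  simp only [Finset.mem_insert, Finset.mem_erase]
  refine ⟨?_, ?_, fun x => ?_⟩
  · rintro C (rfl | hC)
    · simp
    · exact h1 C hC.2
  · rintro C (rfl | hC) D (rfl | hD) x hxC hxD
    · rfl
    · grind
    · grind
    · exact h2 C hC.2 D hD.2 x hxC hxD
  · constructor
    · grind
    · rintro ⟨C, rfl | hC, hx⟩ <;> grind

theorem isPartition_erase_from {P : Finset (Finset ℕ)} {S B : Finset ℕ} {a : ℕ}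
    (hP : IsPartition P (insert a S)) (ha : a ∉ S) (hB : B ∈ P) (haB : a ∈ B) (hne : B ≠ {a}) :
    IsPartition (insert (B.erase a) (P.erase B)) S := by
  rw [isPartition_iff] at hP ⊢
  obtain ⟨h1, h2, h3⟩ := hP
  simp only [Finset.mem_insert, Finset.mem_erase] at h3 ⊢
  refine ⟨?_, ?_, fun x => ?_⟩
  · rintro C (rfl | hC)
    · rw [Finset.nonempty_iff_ne_empty, Ne, Finset.erase_eq_empty_iff]
      grind
    · exact h1 C hC.2
  · rintro C (rfl | hC) D (rfl | hD) x hxC hxD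
    · rfl
    · grind
    · grind
    · exact h2 C hC.2 D hD.2 x hxC hxD
  · constructor
    · intro hx
      obtain ⟨C, hC, hxC⟩ := (h3 x).1 (Or.inr hx)
      grind
    · rintro ⟨C, rfl | hC, hx⟩ <;> grind

theorem sum_partitions_singleton_not_mem (n : ℕ) (f : ℕ → ℝ) :
    ∑ P ∈ (partitions (n + 1)).filter (fun P => {n + 1} ∉ P), f P.card =
      ∑ P ∈ partitions n, (P.card : ℝ) * f P.card := by
  have hn := not_mem_seg n
  have hnew {P : Finset (Finset ℕ)} (hP : IsPartition P (seg n)) (B : Finset ℕ) :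
      insert (n + 1) B ∉ P := fun h =>
    hn (((isPartition_iff.1 hP).2.2 _).2 ⟨_, h, Finset.mem_insert_self _ _⟩)
  have hnew' {P : Finset (Finset ℕ)} {B : Finset ℕ} (hP : IsPartition P (seg n)) (hB : B ∈ P) :
      n + 1 ∉ B := fun h => hn (((isPartition_iff.1 hP).2.2 _).2 ⟨_, hB, h⟩)
  have hmem {P : Finset (Finset ℕ)} (hP : IsPartition P (seg (n + 1))) :=
    blockOf_mem hP (by simp [seg] : n + 1 ∈ seg (n + 1))
  simp_rw [← nsmul_eq_mul, ← Finset.sum_const]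
  rw [Finset.sum_sigma']
  refine Finset.sum_nbij'
    (fun P => ⟨insert ((blockOf P (n + 1)).erase (n + 1)) (P.erase (blockOf P (n + 1))),
      (blockOf P (n + 1)).erase (n + 1)⟩)
    (fun Q => insert (insert (n + 1) Q.2) (Q.1.erase Q.2)) ?_ ?_ ?_ ?_ ?_
  · intro P hP
    simp only [Finset.mem_filter, mem_partitions, Finset.mem_sigma] at hP ⊢
    refine ⟨?_, Finset.mem_insert_self _ _⟩
    obtain ⟨h1, h2⟩ := hmem hP.1
    rw [seg_succ] at hP
    exact isPartition_erase_from hP.1 hn h1 h2 (fun h => hP.2 (h ▸ h1))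
  · rintro ⟨P, B⟩ hP
    simp only [Finset.mem_filter, mem_partitions, Finset.mem_sigma] at hP ⊢
    rw [seg_succ]
    refine ⟨isPartition_insert_into hP.1 hn hP.2, fun h => ?_⟩
    rw [Finset.mem_insert] at h
    rcases h with h | h
    · obtain ⟨x, hx⟩ := (isPartition_iff.1 hP.1).1 _ hP.2
      have h' : x ∈ ({n + 1} : Finset ℕ) := by rw [h]; exact Finset.mem_insert_of_mem hx
      rw [Finset.mem_singleton] at h'
      exact hnew' hP.1 hP.2 (h' ▸ hx)
    · exact hnew hP.1 ∅ (by simpa using Finset.mem_of_mem_erase h)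
  · intro P hP
    simp only [Finset.mem_filter, mem_partitions] at hP
    obtain ⟨h1, h2⟩ := hmem hP.1
    dsimp only
    rw [Finset.insert_erase h2, Finset.erase_insert, Finset.insert_erase h1]
    exact erase_notMem_erase hP.1 h1
  · rintro ⟨P, B⟩ hP
    simp only [mem_partitions, Finset.mem_sigma] at hP
    have hb : blockOf (insert (insert (n + 1) B) (P.erase B)) (n + 1) = insert (n + 1) B :=
      blockOf_eq (isPartition_insert_into hP.1 hn hP.2) (Finset.mem_insert_self _ _)
        (Finset.mem_insert_self _ _)
    dsimp only
    rw [hb, Finset.erase_insert (hnew' hP.1 hP.2), Finset.erase_insert, Finset.insert_erase hP.2]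
    exact fun h => hnew hP.1 B (Finset.mem_of_mem_erase h)
  · intro P hP
    simp only [Finset.mem_filter, mem_partitions] at hP
    obtain ⟨h1, h2⟩ := hmem hP.1
    dsimp only
    rw [Finset.card_insert_of_notMem, Finset.card_erase_add_one h1]
    exact erase_notMem_erase hP.1 h1

theorem sum_partitions_succ (n : ℕ) (f : ℕ → ℝ) :
    ∑ P ∈ partitions (n + 1), f P.card =
      ∑ P ∈ partitions n, ((P.card : ℝ) * f P.card + f (P.card + 1)) := by
  rw [Finset.sum_add_distrib, ← sum_partitions_singleton_mem, ← sum_partitions_singleton_not_mem,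
    add_comm (Finset.sum _ _), Finset.sum_filter_add_sum_filter_not]

/-- The least element of `A` (and `0` if `A` is empty). -/
noncomputable def lo (A : Finset ℕ) : ℕ := sInf (A : Set ℕ)

/-- The greatest element of `A` (and `0` if `A` is empty). -/
def hi (A : Finset ℕ) : ℕ := A.sup id

theorem lo_mem {A : Finset ℕ} (h : A.Nonempty) : lo A ∈ A :=
  Nat.sInf_mem (s := (A : Set ℕ)) h

theorem lo_le {A : Finset ℕ} {x : ℕ} (hx : x ∈ A) : lo A ≤ x :=
  Nat.sInf_le (s := (A : Set ℕ)) hx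

theorem hi_mem {A : Finset ℕ} (h : A.Nonempty) : hi A ∈ A := by
  obtain ⟨x, hx, he⟩ := Finset.exists_mem_eq_sup A h id
  rw [hi, he]
  exact hx

theorem le_hi {A : Finset ℕ} {x : ℕ} (hx : x ∈ A) : x ≤ hi A :=
  Finset.le_sup (f := id) hx

theorem lo_eq {A : Finset ℕ} {a : ℕ} (ha : a ∈ A) (h : ∀ x ∈ A, a ≤ x) : lo A = a :=
  le_antisymm (lo_le ha) (h _ (lo_mem ⟨a, ha⟩))

theorem hi_eq {A : Finset ℕ} {a : ℕ} (ha : a ∈ A) (h : ∀ x ∈ A, x ≤ a) : hi A = a :=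
  le_antisymm (h _ (hi_mem ⟨a, ha⟩)) (le_hi ha)

theorem overlap_iff {A B : Finset ℕ} :
    Overlap A B ↔ A.Nonempty ∧ B.Nonempty ∧ lo A < lo B ∧ lo B < hi A ∧ hi A < hi B := by
  have hlo {A : Finset ℕ} (h : A.Nonempty) : A.min' h = lo A :=
    (lo_eq (A.min'_mem h) fun x hx => A.min'_le x hx).symm
  have hhi {A : Finset ℕ} (h : A.Nonempty) : A.max' h = hi A :=
    (hi_eq (A.max'_mem h) fun x hx => A.le_max' x hx).symm
  simp only [Overlap, hlo, hhi, exists_prop]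

/-- Disjoint nonempty sets, ordered by their minima. -/
def OrderedPair (x : Finset ℕ × Finset ℕ) : Prop :=
  Disjoint x.1 x.2 ∧ x.1.Nonempty ∧ x.2.Nonempty ∧ lo x.1 < lo x.2

/-- Disjoint overlapping sets. -/
def OverlapPair (x : Finset ℕ × Finset ℕ) : Prop :=
  OrderedPair x ∧ lo x.2 < hi x.1 ∧ hi x.1 < hi x.2

/-- Disjoint sets, the first embracing the second. -/
def EmbracePair (x : Finset ℕ × Finset ℕ) : Prop :=
  OrderedPair x ∧ hi x.2 < hi x.1

/-- Nonempty sets, the first lying entirely to the left of the second. -/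
def SeparatedPair (x : Finset ℕ × Finset ℕ) : Prop :=
  OrderedPair x ∧ hi x.1 < lo x.2

/-- Number of (ordered) pairs of blocks of `P` satisfying `Q`. -/
noncomputable def pairCount (Q : Finset ℕ × Finset ℕ → Prop) (P : Finset (Finset ℕ)) : ℕ :=
  ((P ×ˢ P).filter Q).card

theorem ov_eq_pairCount {P : Finset (Finset ℕ)} {S : Finset ℕ} (hP : IsPartition P S) :
    ov P = pairCount OverlapPair P := by
  refine Nat.subtype_card _ fun x => ?_
  rw [isPartition_iff] at hP
  simp only [Finset.mem_filter, Finset.mem_product, OverlapPair, OrderedPair, overlap_iff]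
  constructor
  · tauto
  · rintro ⟨h1, h2, h3, h4, h5, h6, h7⟩
    refine ⟨⟨h1, h2⟩, ⟨Finset.disjoint_left.2 fun y hy1 hy2 => ?_, h3, h4, h5⟩, h6, h7⟩
    rw [hP.2.1 _ h1 _ h2 y hy1 hy2] at h5
    exact lt_irrefl _ h5

theorem pairCount_orderedPair (P : Finset (Finset ℕ)) :
    pairCount OrderedPair P =
      pairCount OverlapPair P + pairCount EmbracePair P + pairCount SeparatedPair P := by
  unfold pairCount
  rw [← Finset.card_union_of_disjoint, ← Finset.card_union_of_disjoint, ← Finset.filter_or,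
    ← Finset.filter_or]
  · congr 1
    refine Finset.filter_congr fun x _ => ?_
    unfold OverlapPair EmbracePair SeparatedPair
    constructor
    · intro h
      obtain ⟨hd, h1, h2, -⟩ := id h
      have h3 : hi x.1 ≠ hi x.2 := fun he =>
        Finset.disjoint_left.1 hd (hi_mem h1) (he ▸ hi_mem h2)
      have h4 : hi x.1 ≠ lo x.2 := fun he =>
        Finset.disjoint_left.1 hd (hi_mem h1) (he ▸ lo_mem h2)
      have h5 : lo x.2 ≤ hi x.2 := lo_le (hi_mem h2)
      rcases lt_or_gt_of_ne h3 with h | h <;> rcases lt_or_gt_of_ne h4 with h' | h' <;> tauto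
    · tauto
  · rw [← Finset.filter_or, Finset.disjoint_filter]
    rintro x - h ⟨⟨-, -, h2, -⟩, h3⟩
    have h5 : lo x.2 ≤ hi x.2 := lo_le (hi_mem h2)
    rcases h with ⟨-, h⟩ | ⟨-, h⟩ <;> omega
  · rw [Finset.disjoint_filter]
    rintro x - ⟨-, h⟩ ⟨-, h'⟩
    omega

theorem card_mul_card_eq {P : Finset (Finset ℕ)} {S : Finset ℕ} (hP : IsPartition P S) :
    P.card * P.card = 2 * pairCount OrderedPair P + P.card := by
  rw [isPartition_iff] at hP
  have hswap : ((P ×ˢ P).filter fun x => OrderedPair x.swap).card = pairCount OrderedPair P := by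
    refine Finset.card_nbij' Prod.swap Prod.swap ?_ ?_ ?_ ?_ <;>
      simp +contextual [Set.MapsTo, Set.LeftInvOn]
  have hoff : P.offDiag = (P ×ˢ P).filter (fun x => OrderedPair x ∨ OrderedPair x.swap) := by
    ext ⟨A, B⟩
    rw [Finset.mem_offDiag, Finset.mem_filter, Finset.mem_product]
    simp only [OrderedPair, Prod.fst_swap, Prod.snd_swap]
    constructor
    · rintro ⟨hA, hB, hne⟩
      have hd : Disjoint A B := Finset.disjoint_left.2 fun x h h' => hne (hP.2.1 A hA B hB x h h')
      have h1 := hP.1 A hA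
      have h2 := hP.1 B hB
      have h3 : lo A ≠ lo B := fun he =>
        Finset.disjoint_left.1 hd (lo_mem h1) (he ▸ lo_mem h2)
      have := hd.symm
      rcases lt_or_gt_of_ne h3 with h | h <;> tauto
    · rintro ⟨⟨hA, hB⟩, h⟩
      refine ⟨hA, hB, ?_⟩
      rintro rfl
      rcases h with ⟨-, -, -, h⟩ | ⟨-, -, -, h⟩ <;> exact lt_irrefl _ h
  have hcard := P.offDiag_card
  rw [hoff, Finset.filter_or, Finset.card_union_of_disjoint, hswap] at hcard
  · unfold pairCount at *
    have : P.card ≤ P.card * P.card := Nat.le_mul_self _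
    omega
  · rw [Finset.disjoint_filter]
    rintro x - ⟨-, -, -, h⟩ ⟨-, -, -, h'⟩
    exact lt_asymm h h'

theorem subset_seg {n : ℕ} {P : Finset (Finset ℕ)} {B : Finset ℕ} (hP : P ∈ partitions n)
    (hB : B ∈ P) : B ⊆ seg n := fun x hx =>
  ((isPartition_iff.1 (mem_partitions.1 hP)).2.2 x).2 ⟨B, hB, hx⟩

/-- Pairs of subsets of `[n]` satisfying `Q`. -/
noncomputable def pairsOf (n : ℕ) (Q : Finset ℕ × Finset ℕ → Prop) :
    Finset (Finset ℕ × Finset ℕ) :=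
  ((seg n).powerset ×ˢ (seg n).powerset).filter Q

theorem mem_pairsOf {n : ℕ} {Q : Finset ℕ × Finset ℕ → Prop} {x : Finset ℕ × Finset ℕ} :
    x ∈ pairsOf n Q ↔ (x.1 ⊆ seg n ∧ x.2 ⊆ seg n) ∧ Q x := by
  simp [pairsOf]

theorem card_filter_mem_pair {n : ℕ} {x : Finset ℕ × Finset ℕ} (hx : OrderedPair x)
    (h1 : x.1 ⊆ seg n) (h2 : x.2 ⊆ seg n) :
    ((partitions n).filter fun P => x.1 ∈ P ∧ x.2 ∈ P).card =
      (setPartitions (seg n \ (x.1 ∪ x.2))).card := by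
  rw [← card_filter_subset (F := {x.1, x.2}) _ (Finset.union_subset h1 h2)]
  · simp only [Finset.insert_subset_iff, Finset.singleton_subset_iff]
    rfl
  · obtain ⟨hd, hA, hB, -⟩ := hx
    rw [Finset.disjoint_left] at hd
    rw [isPartition_iff]
    simp only [Finset.mem_insert, Finset.mem_singleton, Finset.mem_union]
    refine ⟨?_, ?_, by grind⟩
    · rintro B (rfl | rfl) <;> assumption
    · grind

theorem sum_pairCount (n : ℕ) {Q : Finset ℕ × Finset ℕ → Prop} (hQ : ∀ x, Q x → OrderedPair x) :
    ∑ P ∈ partitions n, pairCount Q P =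
      ∑ x ∈ pairsOf n Q, (setPartitions (seg n \ (x.1 ∪ x.2))).card := by
  have h := Finset.sum_card_bipartiteAbove_eq_sum_card_bipartiteBelow (s := partitions n)
    (t := pairsOf n Q) (fun P x => x.1 ∈ P ∧ x.2 ∈ P)
  refine Eq.trans (Finset.sum_congr rfl fun P hP => ?_)
    (h.trans (Finset.sum_congr rfl fun x hx => ?_))
  · unfold pairCount Finset.bipartiteAbove
    congr 1
    ext x
    simp only [Finset.mem_filter, Finset.mem_product, mem_pairsOf]
    have h1 := @subset_seg n P x.1 hP
    have h2 := @subset_seg n P x.2 hP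
    tauto
  · rw [mem_pairsOf] at hx
    exact card_filter_mem_pair (hQ x hx.2) hx.1.1 hx.1.2

theorem sum_le_sum_of_leftInvOn {ι : Type*} (s t : Finset ι) (f : ι → ℕ) (e g : ι → ι)
    (he : ∀ x ∈ s, e x ∈ t) (hg : ∀ x ∈ s, g (e x) = x) (hf : ∀ x ∈ s, f (e x) = f x) :
    ∑ x ∈ s, f x ≤ ∑ x ∈ t, f x := by
  have hinj : Set.InjOn e s := fun x hx y hy h => by rw [← hg x hx, ← hg y hy, h]
  rw [← Finset.sum_congr rfl hf, ← Finset.sum_image hinj]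
  exact Finset.sum_le_sum_of_subset (Finset.image_subset_iff.2 he)

/-- Move the last element of the second set to the first one. -/
noncomputable def moveLeft (x : Finset ℕ × Finset ℕ) : Finset ℕ × Finset ℕ :=
  (insert (hi x.2) x.1, x.2.erase (hi x.2))

/-- Move the last element of the first set to the second one. -/
noncomputable def moveRight (x : Finset ℕ × Finset ℕ) : Finset ℕ × Finset ℕ :=
  (x.1.erase (hi x.1), insert (hi x.1) x.2)

theorem moveLeft_embracePair {x : Finset ℕ × Finset ℕ} (hx : OverlapPair x) :
    EmbracePair (moveLeft x) ∧ moveRight (moveLeft x) = x ∧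
      (moveLeft x).1 ∪ (moveLeft x).2 = x.1 ∪ x.2 := by
  obtain ⟨A, B⟩ := x
  obtain ⟨⟨hd, hA, hB, h1⟩, h2, h3⟩ := hx
  dsimp only at *
  rw [Finset.disjoint_left] at hd
  have hloA := lo_mem hA
  have hloB := lo_mem hB
  have hhiA := hi_mem hA
  have hhiB := hi_mem hB
  have hA1 := fun x => @lo_le A x
  have hA2 := fun x => @le_hi A x
  have hB1 := fun x => @lo_le B x
  have hB2 := fun x => @le_hi B x
  have hhi : hi (insert (hi B) A) = hi B :=
    hi_eq (Finset.mem_insert_self _ _) (by grind)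
  have hlo : lo (insert (hi B) A) = lo A :=
    lo_eq (Finset.mem_insert_of_mem hloA) (by grind)
  have hloB' : lo (B.erase (hi B)) = lo B := lo_eq (by grind) (by grind)
  have hne : (B.erase (hi B)).Nonempty := ⟨lo B, by grind⟩
  have hhiB' := hi_mem hne
  refine ⟨⟨⟨?_, ?_, hne, ?_⟩, ?_⟩, ?_, ?_⟩
  · rw [Finset.disjoint_left]
    simp only [moveLeft]
    grind
  · exact Finset.insert_nonempty _ _
  · simpa only [moveLeft, hlo, hloB']
  · simp only [moveLeft, hhi]
    grind
  · simp only [moveLeft, moveRight, hhi]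
    rw [Finset.erase_insert (by grind), Finset.insert_erase hhiB]
  · simp only [moveLeft]
    grind

theorem moveRight_pair {x : Finset ℕ × Finset ℕ} (hx : EmbracePair x) :
    (OverlapPair (moveRight x) ∨ SeparatedPair (moveRight x)) ∧ moveLeft (moveRight x) = x ∧
      (moveRight x).1 ∪ (moveRight x).2 = x.1 ∪ x.2 := by
  obtain ⟨A, B⟩ := x
  obtain ⟨⟨hd, hA, hB, h1⟩, h2⟩ := hx
  dsimp only at *
  rw [Finset.disjoint_left] at hd
  have hloA := lo_mem hA
  have hloB := lo_mem hB
  have hhiA := hi_mem hA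
  have hhiB := hi_mem hB
  have hA1 := fun x => @lo_le A x
  have hA2 := fun x => @le_hi A x
  have hB1 := fun x => @lo_le B x
  have hB2 := fun x => @le_hi B x
  have hhi : hi (insert (hi A) B) = hi A :=
    hi_eq (Finset.mem_insert_self _ _) (by grind)
  have hlo : lo (insert (hi A) B) = lo B :=
    lo_eq (Finset.mem_insert_of_mem hloB) (by grind)
  have hloA' : lo (A.erase (hi A)) = lo A := lo_eq (by grind) (by grind)
  have hne : (A.erase (hi A)).Nonempty := ⟨lo A, by grind⟩
  have hhiA' := hi_mem hne
  have hord : OrderedPair (moveRight (A, B)) := by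
    refine ⟨?_, hne, Finset.insert_nonempty _ _, ?_⟩
    · rw [Finset.disjoint_left]
      simp only [moveRight]
      grind
    · simpa only [moveRight, hlo, hloA']
  refine ⟨?_, ?_, ?_⟩
  · have h3 : hi (A.erase (hi A)) < hi A := by grind
    have h4 : hi (A.erase (hi A)) ≠ lo B := by grind
    rcases lt_or_gt_of_ne h4 with h | h
    · right
      exact ⟨hord, by simpa only [moveRight, hlo]⟩
    · left
      exact ⟨hord, by simpa only [moveRight, hlo], by simpa only [moveRight, hhi]⟩
  · simp only [moveLeft, moveRight, hhi]
    rw [Finset.erase_insert (by grind), Finset.insert_erase hhiA]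
  · simp only [moveRight]
    grind

theorem sum_overlapPair_le (n : ℕ) :
    ∑ P ∈ partitions n, pairCount OverlapPair P ≤
      ∑ P ∈ partitions n, pairCount EmbracePair P := by
  rw [sum_pairCount n fun x h => h.1, sum_pairCount n fun x h => h.1]
  refine sum_le_sum_of_leftInvOn _ _ _ moveLeft moveRight (fun x hx => ?_) (fun x hx => ?_)
    (fun x hx => ?_) <;>
  · rw [mem_pairsOf] at hx
    obtain ⟨h1, h2, h3⟩ := moveLeft_embracePair hx.2
    first
    | exact h2
    | rw [h3]
    | rw [mem_pairsOf, ← Finset.union_subset_iff, h3]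
      exact ⟨Finset.union_subset hx.1.1 hx.1.2, h1⟩

theorem sum_embracePair_le (n : ℕ) :
    ∑ P ∈ partitions n, pairCount EmbracePair P ≤
      ∑ P ∈ partitions n, pairCount OverlapPair P +
        ∑ P ∈ partitions n, pairCount SeparatedPair P := by
  have hdisj : Disjoint (pairsOf n OverlapPair) (pairsOf n SeparatedPair) := by
    rw [Finset.disjoint_left]
    intro x hx hx'
    have h1 := (mem_pairsOf.1 hx).2.2.1
    have h2 := (mem_pairsOf.1 hx').2.2
    omega
  rw [sum_pairCount n fun x h => h.1, sum_pairCount n fun x h => h.1,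
    sum_pairCount n fun x h => h.1, ← Finset.sum_union hdisj]
  refine sum_le_sum_of_leftInvOn _ _ _ moveRight moveLeft (fun x hx => ?_) (fun x hx => ?_)
    (fun x hx => ?_) <;>
  · rw [mem_pairsOf] at hx
    obtain ⟨h1, h2, h3⟩ := moveRight_pair hx.2
    first
    | exact h2
    | rw [h3]
    | rw [Finset.mem_union, mem_pairsOf, mem_pairsOf, ← and_or_left, ← Finset.union_subset_iff, h3]
      exact ⟨Finset.union_subset hx.1.1 hx.1.2, h1⟩

theorem card_filter_mem {n : ℕ} {U : Finset ℕ} (hU : U ⊆ seg n) (hne : U.Nonempty) :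
    ((partitions n).filter fun P => U ∈ P).card = (setPartitions (seg n \ U)).card := by
  rw [← card_filter_subset (F := {U}) _ hU]
  · simp only [Finset.singleton_subset_iff]
    rfl
  · rw [isPartition_iff]
    simp only [Finset.mem_singleton]
    refine ⟨?_, ?_, by simp⟩
    · rintro B rfl
      exact hne
    · rintro B rfl C rfl _ _ _
      rfl

theorem sum_separatedPair_le (n : ℕ) :
    ∑ P ∈ partitions n, pairCount SeparatedPair P ≤ n * bell n := by
  rw [sum_pairCount n fun x h => h.1]
  set t := ((seg n).powerset ×ˢ seg n).filter fun y => y.2 ∈ y.1 with ht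
  have hcount := Finset.sum_card_bipartiteAbove_eq_sum_card_bipartiteBelow (s := partitions n)
    (t := t) (fun P y => y.1 ∈ P)
  have hle : ∀ P ∈ partitions n, (t.bipartiteAbove (fun P y => y.1 ∈ P) P).card ≤ n := by
    intro P hP
    have hcard : (seg n).card = n := by simp [seg]
    conv_rhs => rw [← hcard]
    refine Finset.card_le_card_of_injOn Prod.snd (fun y hy => ?_) ?_
    · simp only [Finset.bipartiteAbove, ht] at hy
      grind
    · rintro ⟨A, a⟩ hy ⟨B, b⟩ hz h
      simp only [Finset.bipartiteAbove, ht, Finset.coe_filter, Finset.mem_filter,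
        Finset.mem_product, Set.mem_ofPred_eq] at hy hz h
      subst h
      rw [(isPartition_iff.1 (mem_partitions.1 hP)).2.1 A hy.2 B hz.2 a hy.1.2 hz.1.2]
  have hsep : ∀ x ∈ pairsOf n SeparatedPair, (x.1 ∪ x.2, hi x.1) ∈ t := by
    intro x hx
    obtain ⟨⟨h1, h2⟩, ⟨hd, hA, hB, h3⟩, h4⟩ := mem_pairsOf.1 hx
    simp only [ht, Finset.mem_filter, Finset.mem_product, Finset.mem_powerset, Finset.mem_union]
    exact ⟨⟨Finset.union_subset h1 h2, h1 (hi_mem hA)⟩, Or.inl (hi_mem hA)⟩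
  have hinj : Set.InjOn (fun x : Finset ℕ × Finset ℕ => (x.1 ∪ x.2, hi x.1))
      (pairsOf n SeparatedPair) := by
    have hrec : ∀ x ∈ pairsOf n SeparatedPair, x = ((x.1 ∪ x.2).filter fun a => a ≤ hi x.1,
        (x.1 ∪ x.2).filter fun a => ¬ a ≤ hi x.1) := by
      rintro ⟨A, B⟩ hx
      obtain ⟨-, -, h4⟩ := mem_pairsOf.1 hx
      have h5 := fun x => @le_hi A x
      have h6 := fun x => @lo_le B x
      dsimp only at *
      ext a <;> grind
    intro x hx y hy h
    simp only [Prod.mk.injEq] at h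
    rw [hrec x hx, hrec y hy, h.1, h.2]
  calc ∑ x ∈ pairsOf n SeparatedPair, (setPartitions (seg n \ (x.1 ∪ x.2))).card
      = ∑ y ∈ (pairsOf n SeparatedPair).image
          (fun x : Finset ℕ × Finset ℕ => (x.1 ∪ x.2, hi x.1)),
          (setPartitions (seg n \ y.1)).card := by rw [Finset.sum_image hinj]
    _ ≤ ∑ y ∈ t, (setPartitions (seg n \ y.1)).card :=
        Finset.sum_le_sum_of_subset (Finset.image_subset_iff.2 hsep)
    _ = ∑ y ∈ t, ((partitions n).bipartiteBelow (fun P y => y.1 ∈ P) y).card := by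
        refine Finset.sum_congr rfl fun y hy => ?_
        simp only [ht, Finset.mem_filter, Finset.mem_product, Finset.mem_powerset] at hy
        exact (card_filter_mem hy.1.1 ⟨_, hy.2⟩).symm
    _ ≤ n * bell n := by
        rw [← hcount, mul_comm]
        exact Finset.sum_le_card_nsmul _ _ _ hle

theorem sum_ov_bounds (n : ℕ) :
    4 * ∑ P ∈ partitions n, ov P + ∑ P ∈ partitions n, P.card ≤
        ∑ P ∈ partitions n, P.card * P.card ∧
      ∑ P ∈ partitions n, P.card * P.card ≤
        4 * ∑ P ∈ partitions n, ov P + ∑ P ∈ partitions n, P.card + 4 * (n * bell n) := by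
  have h1 := sum_overlapPair_le n
  have h2 := sum_embracePair_le n
  have h3 := sum_separatedPair_le n
  have h4 : ∑ P ∈ partitions n, ov P = ∑ P ∈ partitions n, pairCount OverlapPair P :=
    Finset.sum_congr rfl fun P hP => ov_eq_pairCount (mem_partitions.1 hP)
  have h5 : ∑ P ∈ partitions n, P.card * P.card =
      2 * (∑ P ∈ partitions n, pairCount OverlapPair P +
        ∑ P ∈ partitions n, pairCount EmbracePair P +
        ∑ P ∈ partitions n, pairCount SeparatedPair P) + ∑ P ∈ partitions n, P.card := by
    rw [← Finset.sum_add_distrib, ← Finset.sum_add_distrib, Finset.mul_sum,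
      ← Finset.sum_add_distrib]
    refine Finset.sum_congr rfl fun P hP => ?_
    rw [card_mul_card_eq (mem_partitions.1 hP), pairCount_orderedPair]
  omega

theorem partitions_zero : partitions 0 = {∅} := by
  ext P
  rw [mem_partitions, isPartition_iff, Finset.mem_singleton]
  simp only [seg, Finset.mem_Icc]
  constructor
  · rintro ⟨h1, -, h3⟩
    refine Finset.eq_empty_of_forall_notMem fun B hB => ?_
    obtain ⟨x, hx⟩ := h1 B hB
    have := (h3 x).2 ⟨B, hB, hx⟩
    omega
  · rintro rfl
    simp
    omega

theorem sum_descFactorial_partitions (n x : ℕ) :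
    ∑ P ∈ partitions n, (x.descFactorial P.card : ℝ) = (x : ℝ) ^ n := by
  induction n with
  | zero => simp [partitions_zero]
  | succ n ih =>
    rw [sum_partitions_succ n fun k => (x.descFactorial k : ℝ), pow_succ, ← ih, Finset.sum_mul]
    refine Finset.sum_congr rfl fun P _ => ?_
    rw [Nat.descFactorial_succ]
    rcases le_or_gt P.card x with h | h
    · push_cast [h]
      ring
    · rw [Nat.descFactorial_eq_zero_iff_lt.2 h]
      simp

theorem hasSum_descFactorial_div_factorial (m : ℕ) :
    HasSum (fun k : ℕ => (k.descFactorial m : ℝ) / k.factorial) (Real.exp 1) := by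
  rw [← hasSum_nat_add_iff' m, Finset.sum_eq_zero, sub_zero]
  · have h := NormedSpace.expSeries_div_hasSum_exp (1 : ℝ)
    rw [← Real.exp_eq_exp_ℝ] at h
    refine h.congr_fun ?_
    intro k
    have hk : ((k + m).descFactorial m : ℝ) * k.factorial = (k + m).factorial := by
      have := Nat.factorial_mul_descFactorial (Nat.le_add_left m k)
      rw [Nat.add_sub_cancel] at this
      rw [← this]
      push_cast
      ring
    rw [one_pow, ← hk]
    have h1 : (k.factorial : ℝ) ≠ 0 := by positivity
    have h2 : ((k + m).descFactorial m : ℝ) ≠ 0 := by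
      intro h
      rw [h, zero_mul] at hk
      exact (Nat.factorial_ne_zero (k + m)) (by exact_mod_cast hk.symm)
    field_simp
  · intro k hk
    rw [Nat.descFactorial_eq_zero_iff_lt.2 (Finset.mem_range.1 hk)]
    simp

/-- Dobiński's formula. -/
theorem hasSum_pow_div_factorial (n : ℕ) :
    HasSum (fun k : ℕ => (k : ℝ) ^ n / k.factorial) (Real.exp 1 * bell n) := by
  have h := hasSum_sum (s := partitions n) fun P _ => hasSum_descFactorial_div_factorial P.card
  rw [Finset.sum_const, nsmul_eq_mul, mul_comm] at h
  refine h.congr_fun fun k => ?_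
  rw [← Finset.sum_div, sum_descFactorial_partitions]

theorem bell_pos (n : ℕ) : (0 : ℝ) < bell n := by
  have h := sum_descFactorial_partitions n 1
  by_contra hb
  have h0 : bell n = 0 := by exact_mod_cast le_antisymm (not_lt.1 hb) (Nat.cast_nonneg _)
  rw [Finset.card_eq_zero.1 h0] at h
  simp at h

/-- The ratio of consecutive Bell numbers. -/
noncomputable def bellRatio (n : ℕ) : ℝ := bell (n + 1) / bell n

theorem bellRatio_pos (n : ℕ) : 0 < bellRatio n :=
  div_pos (bell_pos _) (bell_pos _)

theorem bell_succ (n : ℕ) : (bell (n + 1) : ℝ) = bellRatio n * bell n :=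
  (div_mul_cancel₀ _ (bell_pos n).ne').symm

theorem hasSum_succ_pow_div_factorial (n : ℕ) :
    HasSum (fun k : ℕ => ((k : ℝ) + 1) ^ n / k.factorial) (Real.exp 1 * bell (n + 1)) := by
  have h := (hasSum_nat_add_iff' 1).2 (hasSum_pow_div_factorial (n + 1))
  simp only [Finset.sum_range_one, Nat.cast_zero, ne_eq, Nat.add_eq_zero_iff, one_ne_zero,
    and_false, not_false_eq_true, zero_pow, zero_div, sub_zero] at h
  refine h.congr_fun fun k => ?_
  rw [Nat.factorial_succ]
  push_cast
  have : (k.factorial : ℝ) ≠ 0 := by positivity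
  field_simp
  ring

/-- The tangent line inequality for `t ↦ t ^ n` on the nonnegative reals. -/
theorem tangent_le_pow {s t : ℝ} (hs : 0 < s) (ht : 0 ≤ t) (n : ℕ) :
    s ^ n + n * s ^ (n - 1) * (t - s) ≤ t ^ n := by
  rcases n with _ | n
  · simp
  have h := one_add_mul_sub_le_pow (a := t / s) (by linarith [div_nonneg ht hs.le]) (n + 1)
  have h2 := mul_le_mul_of_nonneg_right h (pow_pos hs (n + 1)).le
  rw [div_pow, div_mul_cancel₀ _ (pow_pos hs (n + 1)).ne'] at h2
  refine le_trans (le_of_eq ?_) h2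
  rw [Nat.add_sub_cancel, pow_succ]
  field_simp

theorem one_add_inv_pow_le_bellRatio {n : ℕ} (hn : n ≠ 0) :
    (1 + (bellRatio n)⁻¹) ^ n ≤ bellRatio n := by
  set R := bellRatio n with hR
  have hR0 : 0 < R := bellRatio_pos n
  set s := 1 + R⁻¹ with hs
  have hs0 : 0 < s := by positivity
  set c := n * s ^ (n - 1) with hc
  have hc0 : 0 ≤ c := by positivity
  have h1 := ((hasSum_pow_div_factorial n).mul_left (s ^ n + c / R)).sub
    ((hasSum_pow_div_factorial (n + 1)).mul_left (c / R ^ 2))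
  have h2 := hasSum_le (fun k => ?_) h1 (hasSum_succ_pow_div_factorial n)
  · rw [bell_succ, ← hR] at h2
    have hb : 0 < Real.exp 1 * bell n := mul_pos (Real.exp_pos 1) (bell_pos n)
    refine le_of_mul_le_mul_right ?_ hb
    refine le_trans (le_of_eq ?_) (h2.trans (le_of_eq (by ring)))
    field_simp
    ring
  · rcases k with _ | k
    · simp [hn]
    have hk : (0 : ℝ) < (k + 1 : ℕ) := by positivity
    set x : ℝ := ((k + 1 : ℕ) : ℝ)
    have ht := tangent_le_pow hs0 (t := 1 + x⁻¹) (by positivity) n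
    have hinv : R⁻¹ - x / R ^ 2 ≤ (1 + x⁻¹) - s := by
      rw [hs]
      have : (1 + x⁻¹) - (1 + R⁻¹) - (R⁻¹ - x / R ^ 2) = (x - R) ^ 2 / (x * R ^ 2) := by
        field_simp
        ring
      have : 0 ≤ (x - R) ^ 2 / (x * R ^ 2) := by positivity
      linarith
    have h3 : s ^ n + c * (R⁻¹ - x / R ^ 2) ≤ (1 + x⁻¹) ^ n :=
      le_trans (by gcongr) ht
    have h4 : (x + 1) ^ n = x ^ n * (1 + x⁻¹) ^ n := by
      rw [← mul_pow, mul_add, mul_inv_cancel₀ hk.ne', mul_one]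
    rw [h4, ← mul_div_assoc, ← mul_div_assoc, ← sub_div]
    refine div_le_div_of_nonneg_right ?_ (by positivity)
    refine le_trans (le_of_eq ?_) (mul_le_mul_of_nonneg_left h3 (pow_pos hk n).le)
    rw [pow_succ]
    ring

theorem one_lt_bellRatio {n : ℕ} (hn : n ≠ 0) : 1 < bellRatio n := by
  have h := bellRatio_pos n
  exact lt_of_lt_of_le (one_lt_pow₀ (by simpa using h) hn) (one_add_inv_pow_le_bellRatio hn)

theorem bellRatio_mul_one_sub_inv_pow_le {n : ℕ} (hn : n ≠ 0) :
    bellRatio n * (1 - (bellRatio n)⁻¹) ^ n ≤ 1 := by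
  have hR1 := one_lt_bellRatio hn
  set R := bellRatio n with hR
  have hR0 : 0 < R := bellRatio_pos n
  set s := 1 - R⁻¹ with hs
  have hs0 : 0 < s := sub_pos.2 (inv_lt_one_of_one_lt₀ hR1)
  set c := n * s ^ (n - 1) with hc
  have h1 := ((hasSum_pow_div_factorial (n + 1)).mul_left (s ^ n + c / R)).sub
    ((hasSum_pow_div_factorial n).mul_left c)
  have h1' := (hasSum_nat_add_iff' 1).2 h1
  simp only [Finset.sum_range_one, Nat.cast_zero, ne_eq, Nat.add_eq_zero_iff, one_ne_zero, hn,
    and_false, not_false_eq_true, zero_pow, zero_div, sub_zero, mul_zero] at h1'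
  have h2 := hasSum_le (fun k => ?_) h1' (hasSum_pow_div_factorial n)
  · rw [bell_succ, ← hR] at h2
    have hb : 0 < Real.exp 1 * bell n := mul_pos (Real.exp_pos 1) (bell_pos n)
    refine le_of_mul_le_mul_right ?_ hb
    refine le_trans (le_of_eq ?_) (h2.trans (le_of_eq (by ring)))
    field_simp
    ring
  · rw [Nat.factorial_succ, Nat.cast_mul]
    have hk : (0 : ℝ) < (k + 1 : ℕ) := by positivity
    have hkx : (k : ℝ) = (k + 1 : ℕ) - 1 := by push_cast; ring
    have hx1 : (1 : ℝ) ≤ (k + 1 : ℕ) := by push_cast; linarith [Nat.cast_nonneg (α := ℝ) k]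
    rw [hkx]
    set x : ℝ := ((k + 1 : ℕ) : ℝ)
    have ht := tangent_le_pow hs0 (t := 1 - x⁻¹) (sub_nonneg.2 (inv_le_one_of_one_le₀ hx1)) n
    have h4 : (x - 1) ^ n = x ^ n * (1 - x⁻¹) ^ n := by
      rw [← mul_pow, mul_sub, mul_inv_cancel₀ hk.ne', mul_one]
    have hf : (0 : ℝ) < k.factorial := by positivity
    rw [h4]
    refine le_trans (le_of_eq ?_) (div_le_div_of_nonneg_right
      (mul_le_mul_of_nonneg_left ht (pow_pos hk n).le) hf.le)
    rw [← hc, hs]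
    field_simp
    ring

theorem le_bellRatio_add_one_mul_log {n : ℕ} (hn : n ≠ 0) :
    n ≤ (bellRatio n + 1) * Real.log (bellRatio n) := by
  have h := one_add_inv_pow_le_bellRatio hn
  have hR0 := bellRatio_pos n
  set R := bellRatio n
  have hs0 : 0 < 1 + R⁻¹ := by positivity
  have h1 := Real.log_le_log (pow_pos hs0 n) h
  rw [Real.log_pow] at h1
  have h2 := Real.one_sub_inv_le_log_of_pos hs0
  have h3 : 1 - (1 + R⁻¹)⁻¹ = (R + 1)⁻¹ := by
    field_simp
    ring
  rw [h3] at h2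
  have h4 := (mul_le_mul_of_nonneg_left h2 (Nat.cast_nonneg n)).trans h1
  rw [← div_eq_mul_inv, div_le_iff₀ (by positivity)] at h4
  linarith

theorem bellRatio_sub_one_mul_log_le {n : ℕ} (hn : n ≠ 0) :
    (bellRatio n - 1) * Real.log (bellRatio n) ≤ n := by
  have h := bellRatio_mul_one_sub_inv_pow_le hn
  have hR1 := one_lt_bellRatio hn
  have hR0 := bellRatio_pos n
  set R := bellRatio n
  have hs0 : 0 < 1 - R⁻¹ := sub_pos.2 (inv_lt_one_of_one_lt₀ hR1)
  have h1 := Real.log_le_log (mul_pos hR0 (pow_pos hs0 n)) h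
  rw [Real.log_one, Real.log_mul hR0.ne' (pow_pos hs0 n).ne', Real.log_pow] at h1
  have h2 := Real.one_sub_inv_le_log_of_pos hs0
  have hR1' : 0 < R - 1 := sub_pos.2 hR1
  have h3 : 1 - (1 - R⁻¹)⁻¹ = - (R - 1)⁻¹ := by
    have : 1 - R⁻¹ = (R - 1) / R := by field_simp
    rw [this, inv_div]
    field_simp
    ring
  rw [h3] at h2
  have h4 := mul_le_mul_of_nonneg_left h2 (Nat.cast_nonneg (α := ℝ) n)
  have h5 : Real.log R ≤ n / (R - 1) := by
    rw [div_eq_mul_inv]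
    linarith
  rw [le_div_iff₀ hR1'] at h5
  linarith

theorem sum_card_partitions (n : ℕ) :
    ∑ P ∈ partitions n, (P.card : ℝ) = bell (n + 1) - bell n := by
  have h := sum_partitions_succ n fun _ => 1
  simp only [Finset.sum_const, nsmul_eq_mul, mul_one, Finset.sum_add_distrib] at h
  exact eq_sub_of_add_eq h.symm

theorem sum_card_mul_card_partitions (n : ℕ) :
    ∑ P ∈ partitions n, (P.card : ℝ) * P.card = bell (n + 2) - 2 * bell (n + 1) := by
  have h := sum_partitions_succ n fun k => k
  rw [sum_card_partitions, Finset.sum_add_distrib] at h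
  push_cast at h
  rw [Finset.sum_add_distrib, sum_card_partitions, Finset.sum_const, nsmul_eq_mul] at h
  change _ = _ + (_ + (bell n : ℝ) * 1) at h
  linarith

/-- The average number of overlappings. -/
noncomputable def ovMean (n : ℕ) : ℝ := (∑ π ∈ partitions n, (ov π : ℝ)) / (bell n : ℝ)

theorem ovMean_bounds (n : ℕ) :
    4 * ovMean n ≤ bellRatio n * bellRatio (n + 1) - 3 * bellRatio n + 1 ∧
      bellRatio n * bellRatio (n + 1) - 3 * bellRatio n + 1 ≤ 4 * ovMean n + 4 * n := by
  have hb := bell_pos n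
  obtain ⟨h1, h2⟩ := sum_ov_bounds n
  have h1' := (Nat.cast_le (α := ℝ)).2 h1
  have h2' := (Nat.cast_le (α := ℝ)).2 h2
  push_cast at h1' h2'
  rw [sum_card_partitions, sum_card_mul_card_partitions] at h1' h2'
  have h3 : ∑ π ∈ partitions n, (ov π : ℝ) = ovMean n * bell n :=
    (div_mul_cancel₀ _ hb.ne').symm
  rw [bell_succ (n + 1), bell_succ n, h3] at h1' h2'
  constructor <;> refine le_of_mul_le_mul_right ?_ hb <;> linarith

section Asymptotics

open Filter Topology

theorem tendsto_bellRatio : Tendsto bellRatio atTop atTop := by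
  rw [tendsto_atTop]
  intro b
  filter_upwards [eventually_gt_atTop 0, tendsto_natCast_atTop_atTop.eventually_gt_atTop
    ((b + 1) * b)] with n hn hb
  by_contra! h
  have h0 := bellRatio_pos n
  have h1 := le_bellRatio_add_one_mul_log hn.ne'
  have h2 := Real.log_le_sub_one_of_pos h0
  nlinarith

theorem tendsto_log_bellRatio : Tendsto (fun n => Real.log (bellRatio n)) atTop atTop :=
  Real.tendsto_log_atTop.comp tendsto_bellRatio

theorem tendsto_log_natCast : Tendsto (fun n : ℕ => Real.log n) atTop atTop :=
  Real.tendsto_log_atTop.comp tendsto_natCast_atTop_atTop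

theorem tendsto_log_log_natCast : Tendsto (fun n : ℕ => Real.log (Real.log n)) atTop atTop :=
  Real.tendsto_log_atTop.comp tendsto_log_natCast

theorem tendsto_log_pow_div (k : ℕ) :
    Tendsto (fun n : ℕ => Real.log n ^ k / n) atTop (𝓝 0) :=
  (Real.isLittleO_pow_log_id_atTop (n := k)).tendsto_div_nhds_zero.comp tendsto_natCast_atTop_atTop

theorem abs_bellRatio_mul_log_div_sub_one_le {n : ℕ} (hn : n ≠ 0) :
    |bellRatio n * Real.log (bellRatio n) / n - 1| ≤ Real.log (bellRatio n) / n := by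
  have h1 := le_bellRatio_add_one_mul_log hn
  have h2 := bellRatio_sub_one_mul_log_le hn
  have hn' : (0 : ℝ) < n := by positivity
  rw [div_sub_one hn'.ne', abs_div, abs_of_pos hn']
  refine div_le_div_of_nonneg_right (abs_le.2 ⟨?_, ?_⟩) hn'.le <;> linarith

theorem tendsto_bellRatio_mul_log_div :
    Tendsto (fun n => bellRatio n * Real.log (bellRatio n) / n) atTop (𝓝 1) := by
  rw [tendsto_iff_norm_sub_tendsto_zero]
  have h : Tendsto (fun n => (bellRatio n - 1)⁻¹) atTop (𝓝 0) :=
    tendsto_inv_atTop_zero.comp (tendsto_atTop_add_const_right _ (-1) tendsto_bellRatio)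
  refine squeeze_zero' (Eventually.of_forall fun _ => norm_nonneg _) ?_ h
  filter_upwards [eventually_ne_atTop 0] with n hn
  refine (abs_bellRatio_mul_log_div_sub_one_le hn).trans ?_
  have h1 := bellRatio_sub_one_mul_log_le hn
  have h2 := one_lt_bellRatio hn
  have hn' : (0 : ℝ) < n := by positivity
  rw [div_le_iff₀ hn', inv_mul_eq_div, le_div_iff₀ (sub_pos.2 h2)]
  linarith

theorem tendsto_log_bellRatio_add_log_log_sub :
    Tendsto (fun n : ℕ => Real.log (bellRatio n) + Real.log (Real.log (bellRatio n)) - Real.log n)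
      atTop (𝓝 0) := by
  have h := (Real.continuousAt_log one_ne_zero).tendsto.comp tendsto_bellRatio_mul_log_div
  rw [Real.log_one] at h
  refine h.congr' ?_
  filter_upwards [eventually_ne_atTop 0] with n hn
  have hy := Real.log_pos (one_lt_bellRatio hn)
  have hR := bellRatio_pos n
  have hn' : (n : ℝ) ≠ 0 := Nat.cast_ne_zero.2 hn
  rw [Function.comp_apply, Real.log_div (mul_pos hR hy).ne' hn', Real.log_mul hR.ne' hy.ne']

theorem tendsto_log_div_log_bellRatio :
    Tendsto (fun n : ℕ => Real.log n / Real.log (bellRatio n)) atTop (𝓝 1) := by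
  have h1 := Real.isLittleO_log_id_atTop.tendsto_div_nhds_zero.comp tendsto_log_bellRatio
  have h2 := tendsto_log_bellRatio_add_log_log_sub.mul
    (tendsto_inv_atTop_zero.comp tendsto_log_bellRatio)
  have h3 := (h1.sub h2).const_add 1
  simp only [mul_zero, sub_zero, add_zero] at h3
  refine h3.congr' ?_
  filter_upwards [eventually_ne_atTop 0] with n hn
  have hy := Real.log_pos (one_lt_bellRatio hn)
  simp only [Function.comp_apply, id]
  field_simp
  ring

theorem tendsto_log_sub_log_bellRatio_div :
    Tendsto (fun n : ℕ => (Real.log n - Real.log (bellRatio n)) / Real.log (Real.log n))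
      atTop (𝓝 1) := by
  have h := (Real.continuousAt_log one_ne_zero).tendsto.comp tendsto_log_div_log_bellRatio
  rw [Real.log_one] at h
  have h1 := ((tendsto_log_bellRatio_add_log_log_sub.add h).mul
    (tendsto_inv_atTop_zero.comp tendsto_log_log_natCast)).const_sub 1
  simp only [mul_zero, sub_zero] at h1
  refine h1.congr' ?_
  filter_upwards [eventually_ne_atTop 0, tendsto_log_natCast.eventually_gt_atTop 0,
    tendsto_log_log_natCast.eventually_gt_atTop 0] with n hn hL hl
  have hy := Real.log_pos (one_lt_bellRatio hn)
  simp only [Function.comp_apply]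
  rw [Real.log_div hL.ne' hy.ne']
  field_simp
  ring

theorem tendsto_bellRatio_mul_log_natCast_div :
    Tendsto (fun n : ℕ => bellRatio n * Real.log n / n) atTop (𝓝 1) := by
  have h := tendsto_bellRatio_mul_log_div.mul tendsto_log_div_log_bellRatio
  rw [mul_one] at h
  refine h.congr' ?_
  filter_upwards [eventually_ne_atTop 0] with n hn
  have hy := Real.log_pos (one_lt_bellRatio hn)
  field_simp

theorem tendsto_bellRatio_mul_log_natCast_div_sub_one_mul :
    Tendsto (fun n : ℕ => (bellRatio n * Real.log n / n - 1) *
      (Real.log n / Real.log (Real.log n))) atTop (𝓝 1) := by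
  have herr : Tendsto (fun n : ℕ => (bellRatio n * Real.log (bellRatio n) / n - 1) *
      (Real.log n / Real.log (Real.log n))) atTop (𝓝 0) := by
    have h1 := ((tendsto_log_div_log_bellRatio.inv₀ one_ne_zero).mul (tendsto_log_pow_div 2)).mul
      (tendsto_inv_atTop_zero.comp tendsto_log_log_natCast)
    rw [mul_zero] at h1
    refine squeeze_zero_norm' ?_ h1
    filter_upwards [eventually_ne_atTop 0, tendsto_log_natCast.eventually_gt_atTop 0,
      tendsto_log_log_natCast.eventually_gt_atTop 0] with n hn hL hl
    rw [norm_mul, Real.norm_eq_abs, Real.norm_of_nonneg (div_pos hL hl).le]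
    refine (mul_le_mul_of_nonneg_right (abs_bellRatio_mul_log_div_sub_one_le hn)
      (div_pos hL hl).le).trans (le_of_eq ?_)
    have hy := Real.log_pos (one_lt_bellRatio hn)
    simp only [Function.comp_apply]
    field_simp
  have h := ((tendsto_bellRatio_mul_log_div.mul tendsto_log_div_log_bellRatio).mul
    tendsto_log_sub_log_bellRatio_div).add herr
  simp only [mul_one, add_zero] at h
  refine h.congr' ?_
  filter_upwards [eventually_ne_atTop 0, tendsto_log_natCast.eventually_gt_atTop 0,
    tendsto_log_log_natCast.eventually_gt_atTop 0] with n hn hL hl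
  have hy := Real.log_pos (one_lt_bellRatio hn)
  field_simp
  ring

theorem abs_bellRatio_succ_sub_le {n : ℕ} (hn : n ≠ 0) (h : 1 ≤ Real.log (bellRatio n)) :
    |bellRatio (n + 1) - bellRatio n| ≤ 3 := by
  have h1 := le_bellRatio_add_one_mul_log hn
  have h2 := bellRatio_sub_one_mul_log_le hn
  have h3 := le_bellRatio_add_one_mul_log n.succ_ne_zero
  have h4 := bellRatio_sub_one_mul_log_le n.succ_ne_zero
  have hR := bellRatio_pos n
  have hR' := bellRatio_pos (n + 1)
  push_cast at h3 h4
  rw [abs_le]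
  constructor
  · by_contra! hlt
    have hlog := Real.log_le_log hR' (by linarith : bellRatio (n + 1) ≤ bellRatio n)
    nlinarith
  · by_contra! hlt
    have hlog := Real.log_le_log hR (by linarith : bellRatio n ≤ bellRatio (n + 1))
    nlinarith

theorem abs_four_mul_ovMean_sub_le {n : ℕ} (hn : n ≠ 0) (h : 1 ≤ Real.log (bellRatio n)) :
    |4 * ovMean n - bellRatio n ^ 2| ≤ 16 * (n : ℝ) := by
  obtain ⟨h1, h2⟩ := ovMean_bounds n
  obtain ⟨h3, h4⟩ := abs_le.1 (abs_bellRatio_succ_sub_le hn h)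
  have hR := one_lt_bellRatio hn
  have h5 := bellRatio_sub_one_mul_log_le hn
  have hn' : (1 : ℝ) ≤ n := by exact_mod_cast Nat.one_le_iff_ne_zero.2 hn
  have h6 : bellRatio n ≤ n + 1 := by nlinarith
  rw [abs_le]
  constructor <;> nlinarith

end Asymptotics

/-- asymptotics of the average number of overlappings. -/
theorem ov_mean_asymptotics :
    ∃ ε : ℕ → ℝ, Filter.Tendsto ε Filter.atTop (nhds 0) ∧
      ∀ᶠ n : ℕ in Filter.atTop,
        (∑ π ∈ partitions n, (ov π : ℝ)) / (bell n : ℝ)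
          = (1/4) * ((n : ℝ) / Real.log n)^2 *
              (1 + 2 * (Real.log (Real.log n) / Real.log n) * (1 + ε n)) := by
  refine ⟨fun n => (4 * ovMean n * (Real.log n / n) ^ 2 - 1) *
    (Real.log n / (2 * Real.log (Real.log n))) - 1, ?_, ?_⟩
  · have herr : Filter.Tendsto (fun n : ℕ => (4 * ovMean n - bellRatio n ^ 2) *
        (Real.log n ^ 3 / (n ^ 2 * (2 * Real.log (Real.log n))))) Filter.atTop (nhds 0) := by
      have h := ((tendsto_log_pow_div 3).mul
        (tendsto_inv_atTop_zero.comp tendsto_log_log_natCast)).const_mul 8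
      rw [mul_zero, mul_zero] at h
      refine squeeze_zero_norm' ?_ h
      filter_upwards [Filter.eventually_ne_atTop 0, tendsto_log_natCast.eventually_gt_atTop 0,
        tendsto_log_log_natCast.eventually_gt_atTop 0,
        tendsto_log_bellRatio.eventually_ge_atTop 1] with n hn hL hl hy
      have hn' : (0 : ℝ) < n := by positivity
      rw [norm_mul, Real.norm_eq_abs, Real.norm_of_nonneg (by positivity)]
      refine (mul_le_mul_of_nonneg_right (abs_four_mul_ovMean_sub_le hn hy)
        (by positivity)).trans (le_of_eq ?_)
      simp only [Function.comp_apply]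
      field_simp
      ring
    have h := (((tendsto_bellRatio_mul_log_natCast_div_sub_one_mul.mul
      (tendsto_bellRatio_mul_log_natCast_div.add_const 1)).div_const 2).add herr).sub_const 1
    norm_num at h
    refine h.congr' ?_
    filter_upwards [Filter.eventually_ne_atTop 0, tendsto_log_natCast.eventually_gt_atTop 0,
      tendsto_log_log_natCast.eventually_gt_atTop 0] with n hn hL hl
    have hn' : (0 : ℝ) < n := by positivity
    field_simp
    ring
  · filter_upwards [Filter.eventually_ne_atTop 0, tendsto_log_natCast.eventually_gt_atTop 0,
      tendsto_log_log_natCast.eventually_gt_atTop 0] with n hn hL hl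
    have hn' : (0 : ℝ) < n := by positivity
    change ovMean n = _
    field_simp
    ring
end

section
/- For every integer n ≥ 1 one has the identity (in ℚ): Σ_{π ∈ Π_n} emb(π) = (1/4)·B_{n+2} − (5/4)·B_{n+1} + (3/4)·B_n + (n/2)·B_{n−1}. Equivalently, the average number of embracings in a random set partition of [n] equals this quantity divided by B_n. -/
open scoped Classical

/-- The set partitions of an arbitrary finite set `S`. -/
noncomputable def partitionsOf (S : Finset ℕ) : Finset (Finset (Finset ℕ)) :=
  S.powerset.powerset.filter fun P => IsPartition P S

theorem IsPartition.subset {P : Finset (Finset ℕ)} {S B : Finset ℕ} (h : IsPartition P S)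
    (hB : B ∈ P) : B ⊆ S := by
  rw [← h.2.2]
  exact Finset.subset_biUnion_of_mem id hB

theorem mem_partitionsOf {P : Finset (Finset ℕ)} {S : Finset ℕ} :
    P ∈ partitionsOf S ↔ IsPartition P S := by
  simp only [partitionsOf, Finset.mem_filter, Finset.mem_powerset, and_iff_right_iff_imp]
  exact fun h B hB => Finset.mem_powerset.2 (h.subset hB)

theorem IsPartition.erase {P : Finset (Finset ℕ)} {S B : Finset ℕ} (h : IsPartition P S)
    (hB : B ∈ P) : IsPartition (P.erase B) (S \ B) := by
  refine ⟨fun h0 => h.1 (Finset.mem_of_mem_erase h0), fun C hC D hD =>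
    h.2.1 C (Finset.mem_of_mem_erase hC) D (Finset.mem_of_mem_erase hD), ?_⟩
  ext x
  simp only [Finset.mem_biUnion, Finset.mem_erase, id, Finset.mem_sdiff, ← h.2.2]
  constructor
  · rintro ⟨C, ⟨hne, hC⟩, hx⟩
    exact ⟨⟨C, hC, hx⟩, Finset.disjoint_left.1 (h.2.1 C hC B hB hne) hx⟩
  · rintro ⟨⟨C, hC, hx⟩, hxB⟩
    exact ⟨C, ⟨fun e => hxB (e ▸ hx), hC⟩, hx⟩

theorem IsPartition.notMem_of_sdiff {Q : Finset (Finset ℕ)} {S B : Finset ℕ}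
    (h : IsPartition Q (S \ B)) (hB : B.Nonempty) : B ∉ Q := by
  obtain ⟨x, hx⟩ := hB
  exact fun hQ => (Finset.mem_sdiff.1 (h.subset hQ hx)).2 hx

theorem IsPartition.insert {Q : Finset (Finset ℕ)} {S B : Finset ℕ}
    (h : IsPartition Q (S \ B)) (hB : B.Nonempty) (hBS : B ⊆ S) :
    IsPartition (insert B Q) S := by
  have hd : ∀ C ∈ Q, Disjoint C B := fun C hC =>
    Finset.disjoint_of_subset_left (h.subset hC) Finset.sdiff_disjoint
  refine ⟨?_, ?_, ?_⟩
  · rw [Finset.mem_insert, not_or]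
    exact ⟨hB.ne_empty.symm, h.1⟩
  · intro C hC D hD hne
    rcases Finset.mem_insert.1 hC with hCB | hCQ <;>
      rcases Finset.mem_insert.1 hD with hDB | hDQ
    · exact absurd (hCB.trans hDB.symm) hne
    · exact hCB ▸ (hd D hDQ).symm
    · exact hDB ▸ hd C hCQ
    · exact h.2.1 C hCQ D hDQ hne
  · rw [Finset.biUnion_insert, h.2.2]
    exact Finset.union_sdiff_of_subset hBS

theorem sum_partitionsOf_erase {M : Type*} [AddCommMonoid M] {S B : Finset ℕ} (hB : B.Nonempty)
    (hBS : B ⊆ S) (f : Finset (Finset ℕ) → M) :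
    ∑ P ∈ partitionsOf S with B ∈ P, f (P.erase B) = ∑ Q ∈ partitionsOf (S \ B), f Q := by
  refine Finset.sum_nbij' (fun P => P.erase B) (fun Q => insert B Q) ?_ ?_ ?_ ?_ fun _ _ => rfl
  · intro P hP
    rw [Finset.mem_filter, mem_partitionsOf] at hP
    exact mem_partitionsOf.2 (hP.1.erase hP.2)
  · intro Q hQ
    rw [mem_partitionsOf] at hQ
    exact Finset.mem_filter.2
      ⟨mem_partitionsOf.2 (hQ.insert hB hBS), Finset.mem_insert_self _ _⟩
  · intro P hP
    exact Finset.insert_erase (Finset.mem_filter.1 hP).2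
  · intro Q hQ
    exact Finset.erase_insert ((mem_partitionsOf.1 hQ).notMem_of_sdiff hB)

theorem card_partitionsOf_filter_mem {S B : Finset ℕ} (hB : B.Nonempty) (hBS : B ⊆ S) :
    ((partitionsOf S).filter fun P => B ∈ P).card = (partitionsOf (S \ B)).card := by
  simpa using sum_partitionsOf_erase hB hBS fun _ => (1 : ℕ)

theorem card_partitionsOf_filter_mem_mem {S B C : Finset ℕ} (hB : B.Nonempty) (hBS : B ⊆ S)
    (hC : C.Nonempty) (hCS : C ⊆ S) (hBC : Disjoint B C) :
    ((partitionsOf S).filter fun P => B ∈ P ∧ C ∈ P).card =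
      (partitionsOf (S \ (B ∪ C))).card := by
  have hne : C ≠ B := by
    rintro rfl
    exact hC.ne_empty (Finset.disjoint_self_iff_empty _ |>.1 hBC)
  have h := sum_partitionsOf_erase hB hBS fun Q => if C ∈ Q then 1 else 0
  simp only [Finset.mem_erase, hne, ne_eq, not_false_eq_true, true_and,
    Finset.sum_boole, Finset.filter_filter, Nat.cast_id] at h
  rw [h, card_partitionsOf_filter_mem hC, Finset.sdiff_sdiff_left']
  · congr 2
    ext x
    simp only [Finset.mem_inter, Finset.mem_sdiff, Finset.mem_union]
    tauto
  · exact Finset.subset_sdiff.2 ⟨hCS, hBC.symm⟩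

theorem sum_powerset_bell_card_sdiff (S : Finset ℕ) :
    ∑ T ∈ S.powerset, Nat.bell (S \ T).card = Nat.bell (S.card + 1) := by
  rw [Nat.bell_succ, Finset.sum_congr rfl fun T hT => by
    rw [Finset.card_sdiff_of_subset (Finset.mem_powerset.1 hT)],
    Finset.sum_powerset_apply_card fun m => Nat.bell (S.card - m), Nat.range_succ_eq_Iic]
  simp

theorem card_partitionsOf (S : Finset ℕ) : (partitionsOf S).card = Nat.bell S.card := by
  induction S using Finset.strongInduction with
  | H S ih =>
    rcases S.eq_empty_or_nonempty with rfl | ⟨a, ha⟩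
    · rw [Finset.card_empty, Nat.bell_zero, Finset.card_eq_one]
      refine ⟨∅, ?_⟩
      ext P
      rw [mem_partitionsOf, Finset.mem_singleton]
      constructor
      · intro h
        refine Finset.eq_empty_of_forall_notMem fun B hB => h.1 ?_
        rwa [← Finset.subset_empty.1 (h.subset hB)]
      · rintro rfl
        simp [IsPartition]
    · have hmaps : (partitionsOf S).card = ∑ T ∈ (S.erase a).powerset,
          ((partitionsOf S).filter fun P => insert a T ∈ P).card := by
        simp only [Finset.card_filter]
        rw [Finset.sum_comm, Finset.card_eq_sum_ones]
        refine Finset.sum_congr rfl fun P hP => ?_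
        rw [mem_partitionsOf] at hP
        obtain ⟨B, hB, haB⟩ : ∃ B ∈ P, a ∈ B := by
          simpa [← hP.2.2] using ha
        rw [Finset.sum_boole, Nat.cast_id, eq_comm, Finset.card_eq_one]
        refine ⟨B.erase a, ?_⟩
        ext T
        simp only [Finset.mem_filter, Finset.mem_powerset, Finset.mem_singleton]
        constructor
        · rintro ⟨hT, hTP⟩
          have haT : a ∉ T := fun h => by simpa using hT h
          have : insert a T = B := by
            by_contra hne
            exact Finset.disjoint_left.1 (hP.2.1 _ hTP B hB hne)
              (Finset.mem_insert_self a T) haB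
          rw [← this, Finset.erase_insert haT]
        · rintro rfl
          exact ⟨Finset.erase_subset_erase a (hP.subset hB), by rwa [Finset.insert_erase haB]⟩
      rw [hmaps, ← Finset.card_erase_add_one ha, ← sum_powerset_bell_card_sdiff]
      refine Finset.sum_congr rfl fun T hT => ?_
      have hTS : insert a T ⊆ S := Finset.insert_subset ha
        ((Finset.mem_powerset.1 hT).trans (Finset.erase_subset a S))
      rw [card_partitionsOf_filter_mem (Finset.insert_nonempty a T) hTS,
        ih _ (Finset.sdiff_ssubset hTS (Finset.insert_nonempty a T)),
        Finset.sdiff_insert, Finset.erase_sdiff_comm]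

theorem bell_eq_nat_bell (n : ℕ) : bell n = Nat.bell n := by
  have h := card_partitionsOf (seg n)
  rwa [seg, Nat.card_Icc, Nat.add_sub_cancel] at h

theorem sum_powerset_two_pow_mul_bell (S : Finset ℕ) :
    ∑ U ∈ S.powerset, 2 ^ U.card * Nat.bell (S \ U).card + Nat.bell (S.card + 1) =
      Nat.bell (S.card + 2) := by
  obtain ⟨a, ha⟩ := Infinite.exists_notMem_finset S
  have hcard : S.card + 2 = (insert a S).card + 1 := by rw [Finset.card_insert_of_notMem ha]
  rw [hcard, ← sum_powerset_bell_card_sdiff, ← sum_powerset_bell_card_sdiff,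
    Finset.sum_powerset_insert ha]
  congr 1
  · have h1 : ∀ T ∈ S.powerset, Nat.bell (insert a S \ T).card =
        ∑ R ∈ (S \ T).powerset, Nat.bell (S \ (T ∪ R)).card := by
      intro T hT
      have haT : a ∉ T := fun h => ha (Finset.mem_powerset.1 hT h)
      rw [Finset.insert_sdiff_of_notMem _ haT, Finset.card_insert_of_notMem (by simp [ha]),
        ← sum_powerset_bell_card_sdiff]
      simp only [Finset.sdiff_sdiff_left']
      refine Finset.sum_congr rfl fun R _ => ?_
      congr 2
      ext x
      simp only [Finset.mem_inter, Finset.mem_sdiff, Finset.mem_union]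
      tauto
    rw [Finset.sum_congr rfl h1, Finset.sum_sigma']
    have h2 : ∀ U ∈ S.powerset, 2 ^ U.card * Nat.bell (S \ U).card =
        ∑ _T ∈ U.powerset, Nat.bell (S \ U).card := by simp
    rw [Finset.sum_congr rfl h2, Finset.sum_sigma']
    refine Finset.sum_nbij' (fun x => ⟨x.2, x.1 \ x.2⟩) (fun x => ⟨x.1 ∪ x.2, x.1⟩) ?_ ?_ ?_ ?_ ?_
    · rintro ⟨U, T⟩ h
      simp only [Finset.mem_sigma, Finset.mem_powerset] at h ⊢
      exact ⟨h.2.trans h.1, Finset.sdiff_subset_sdiff h.1 subset_rfl⟩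
    · rintro ⟨T, R⟩ h
      simp only [Finset.mem_sigma, Finset.mem_powerset] at h ⊢
      exact ⟨Finset.union_subset h.1 (h.2.trans Finset.sdiff_subset), Finset.subset_union_left⟩
    · rintro ⟨U, T⟩ h
      simp only [Finset.mem_sigma, Finset.mem_powerset] at h
      simp [Finset.union_sdiff_of_subset h.2]
    · rintro ⟨T, R⟩ h
      simp only [Finset.mem_sigma, Finset.mem_powerset] at h
      simp [Finset.union_sdiff_cancel_left (Finset.subset_sdiff.1 h.2).2.symm]
    · rintro ⟨U, T⟩ h
      simp only [Finset.mem_sigma, Finset.mem_powerset] at h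
      simp [Finset.union_sdiff_of_subset h.2]
  · refine Finset.sum_congr rfl fun T _ => ?_
    rw [Finset.insert_sdiff_insert, Finset.sdiff_insert_of_notMem ha]

theorem card_filter_embrace_sdiff (U : Finset ℕ) :
    (U.powerset.filter fun C => Embrace (U \ C) C).card = 2 ^ (U.card - 2) - 1 := by
  rcases lt_or_ge U.card 2 with hU | hU
  · have h0 : 2 ^ (U.card - 2) - 1 = 0 := by
      rw [Nat.sub_eq_zero_of_le hU.le, pow_zero, Nat.sub_self]
    rw [h0, Finset.card_eq_zero, Finset.filter_eq_empty_iff]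
    rintro C hC ⟨hB, hC', hlt, -⟩
    have h1 := Finset.card_sdiff_add_card_eq_card (Finset.mem_powerset.1 hC)
    have := hB.card_pos
    have := hC'.card_pos
    omega
  · have hne : U.Nonempty := Finset.card_pos.1 (by omega)
    have hlt : U.min' hne < U.max' hne := Finset.min'_lt_max'_of_card U (by omega)
    have hset : (U.powerset.filter fun C => Embrace (U \ C) C) =
        ((U.erase (U.min' hne)).erase (U.max' hne)).powerset.erase ∅ := by
      ext C
      simp only [Finset.mem_filter, Finset.mem_powerset, Finset.mem_erase]
      constructor
      · rintro ⟨hCU, hB, hC, h1, -, h2⟩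
        refine ⟨hC.ne_empty, fun x hx => ?_⟩
        have hmin := Finset.min'_le C x hx
        have hmax := Finset.le_max' C x hx
        have hmin' := U.min'_le _ (Finset.mem_sdiff.1 (Finset.min'_mem _ hB)).1
        have hmax' := U.le_max' _ (Finset.mem_sdiff.1 (Finset.max'_mem _ hB)).1
        simp only [Finset.mem_erase]
        exact ⟨by omega, by omega, hCU hx⟩
      · rintro ⟨hC, hCU⟩
        have hC := Finset.nonempty_iff_ne_empty.2 hC
        have hmem : ∀ x ∈ C, x ≠ U.max' hne ∧ x ≠ U.min' hne ∧ x ∈ U := fun x hx => by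
          simpa using hCU hx
        have hminB : U.min' hne ∈ U \ C := Finset.mem_sdiff.2
          ⟨U.min'_mem hne, fun h => (hmem _ h).2.1 rfl⟩
        have hmaxB : U.max' hne ∈ U \ C := Finset.mem_sdiff.2
          ⟨U.max'_mem hne, fun h => (hmem _ h).1 rfl⟩
        refine ⟨fun x hx => (hmem x hx).2.2, ⟨_, hminB⟩, hC, ?_, Finset.min'_le_max' C hC, ?_⟩
        · have h := hmem _ (C.min'_mem hC)
          exact (Finset.min'_le _ _ hminB).trans_lt
            (lt_of_le_of_ne (U.min'_le _ h.2.2) h.2.1.symm)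
        · have h := hmem _ (C.max'_mem hC)
          exact (lt_of_le_of_ne (U.le_max' _ h.2.2) h.1).trans_le (Finset.le_max' _ _ hmaxB)
    rw [hset, Finset.card_erase_of_mem (Finset.empty_mem_powerset _), Finset.card_powerset,
      Finset.card_erase_of_mem (Finset.mem_erase.2 ⟨hlt.ne', U.max'_mem hne⟩),
      Finset.card_erase_of_mem (U.min'_mem hne), Nat.sub_sub]

theorem not_embrace_self (B : Finset ℕ) : ¬ Embrace B B :=
  fun ⟨_, _, h, _⟩ => lt_irrefl _ h

theorem emb_eq_sum {P : Finset (Finset ℕ)} {S : Finset ℕ} (hP : IsPartition P S) :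
    emb P = ∑ p ∈ (S.powerset ×ˢ S.powerset).filter fun p => Embrace p.1 p.2 ∧ Disjoint p.1 p.2,
      if p.1 ∈ P ∧ p.2 ∈ P then 1 else 0 := by
  rw [Finset.sum_boole, Nat.cast_id, Finset.filter_filter]
  refine Nat.subtype_card _ fun p => ?_
  simp only [Finset.mem_filter, Finset.mem_product, Finset.mem_powerset]
  constructor
  · rintro ⟨-, ⟨h1, -⟩, h2, h3⟩
    exact ⟨h2, h3, h1⟩
  · rintro ⟨h1, h2, h3⟩
    refine ⟨⟨hP.subset h1, hP.subset h2⟩, ⟨h3, hP.2.1 _ h1 _ h2 fun e => ?_⟩, h1, h2⟩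
    exact not_embrace_self _ (e ▸ h3)

theorem sum_emb_partitionsOf (S : Finset ℕ) :
    ∑ P ∈ partitionsOf S, emb P =
      ∑ U ∈ S.powerset, (2 ^ (U.card - 2) - 1) * Nat.bell (S \ U).card := by
  rw [Finset.sum_congr rfl fun P hP => emb_eq_sum (mem_partitionsOf.1 hP), Finset.sum_comm]
  have h2 : ∀ U ∈ S.powerset, (2 ^ (U.card - 2) - 1) * Nat.bell (S \ U).card =
      ∑ _C ∈ U.powerset.filter fun C => Embrace (U \ C) C, Nat.bell (S \ U).card := by
    intro U _
    rw [Finset.sum_const, card_filter_embrace_sdiff, smul_eq_mul]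
  rw [Finset.sum_congr rfl h2, Finset.sum_sigma' S.powerset]
  refine Finset.sum_nbij' (fun p => ⟨p.1 ∪ p.2, p.2⟩) (fun x => (x.1 \ x.2, x.2)) ?_ ?_ ?_ ?_ ?_
  · rintro ⟨B, C⟩ h
    simp only [Finset.mem_filter, Finset.mem_product, Finset.mem_powerset] at h
    simp only [Finset.mem_sigma, Finset.mem_filter, Finset.mem_powerset]
    refine ⟨Finset.union_subset h.1.1 h.1.2, Finset.subset_union_right, ?_⟩
    rw [Finset.union_sdiff_cancel_right h.2.2]
    exact h.2.1
  · rintro ⟨U, C⟩ h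
    simp only [Finset.mem_sigma, Finset.mem_filter, Finset.mem_powerset] at h
    simp only [Finset.mem_filter, Finset.mem_product, Finset.mem_powerset]
    exact ⟨⟨Finset.sdiff_subset.trans h.1, h.2.1.trans h.1⟩, h.2.2, Finset.sdiff_disjoint⟩
  · rintro ⟨B, C⟩ h
    simp only [Finset.mem_filter] at h
    simp [Finset.union_sdiff_cancel_right h.2.2]
  · rintro ⟨U, C⟩ h
    simp only [Finset.mem_sigma, Finset.mem_filter, Finset.mem_powerset] at h
    simp [Finset.sdiff_union_of_subset h.2.1]
  · rintro ⟨B, C⟩ h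
    simp only [Finset.mem_filter, Finset.mem_product, Finset.mem_powerset] at h
    obtain ⟨⟨hBS, hCS⟩, ⟨hB, hC, -⟩, hd⟩ := h
    rw [Finset.sum_boole, Nat.cast_id, card_partitionsOf_filter_mem_mem hB hBS hC hCS hd,
      card_partitionsOf]

theorem cast_two_pow_sub_two_sub_one (m : ℕ) :
    ((2 ^ (m - 2) - 1 : ℕ) : ℚ) =
      (1/4) * 2 ^ m - 1 + (if m = 0 then 3/4 else 0) + (if m = 1 then 1/2 else 0) := by
  rcases m with _ | _ | m
  · norm_num
  · norm_num
  · rw [show m + 1 + 1 - 2 = m by omega, Nat.cast_sub Nat.one_le_two_pow]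
    simp [pow_succ]
    ring

theorem sum_emb_partitions (n : ℕ) :
    (∑ π ∈ partitions n, (emb π : ℚ)) =
      (1/4) * (bell (n+2) : ℚ) - (5/4) * (bell (n+1) : ℚ)
        + (3/4) * (bell n : ℚ) + ((n : ℚ)/2) * (bell (n-1) : ℚ) := by
  have hcard : (seg n).card = n := by simp [seg]
  have hE := congrArg (Nat.cast : ℕ → ℚ) (sum_emb_partitionsOf (seg n))
  have hB := congrArg (Nat.cast : ℕ → ℚ) (sum_powerset_bell_card_sdiff (seg n))
  have hT := congrArg (Nat.cast : ℕ → ℚ) (sum_powerset_two_pow_mul_bell (seg n))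
  have h0 : ∑ U ∈ (seg n).powerset,
      (if U.card = 0 then (3/4 : ℚ) else 0) * Nat.bell (seg n \ U).card =
        3/4 * Nat.bell n := by
    rw [Finset.sum_eq_single ∅]
    · simp [hcard]
    · intro U _ hU
      simp [hU]
    · simp
  have h1 : ∑ U ∈ (seg n).powerset,
      (if U.card = 1 then (1/2 : ℚ) else 0) * Nat.bell (seg n \ U).card =
        n / 2 * Nat.bell (n - 1) := by
    have h : ∀ U ∈ (seg n).powerset,
        (if U.card = 1 then (1/2 : ℚ) else 0) * Nat.bell (seg n \ U).card =
          if U.card = 1 then 1/2 * (Nat.bell (n - 1) : ℚ) else 0 := by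
      intro U hU
      split_ifs with h
      · rw [Finset.card_sdiff_of_subset (Finset.mem_powerset.1 hU), hcard, h]
      · rw [zero_mul]
    rw [Finset.sum_congr rfl h, ← Finset.sum_filter, ← Finset.powersetCard_eq_filter,
      Finset.sum_const, Finset.card_powersetCard, hcard, Nat.choose_one_right, nsmul_eq_mul]
    ring
  push_cast [hcard] at hE hB hT
  simp only [bell_eq_nat_bell]
  calc
    _ = _ := hE
    _ = 1/4 * ∑ U ∈ (seg n).powerset, (2 : ℚ) ^ U.card * Nat.bell (seg n \ U).card
        - ∑ U ∈ (seg n).powerset, (Nat.bell (seg n \ U).card : ℚ)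
        + ∑ U ∈ (seg n).powerset,
          (if U.card = 0 then (3/4 : ℚ) else 0) * Nat.bell (seg n \ U).card
        + ∑ U ∈ (seg n).powerset,
          (if U.card = 1 then (1/2 : ℚ) else 0) * Nat.bell (seg n \ U).card := by
      rw [Finset.mul_sum, ← Finset.sum_sub_distrib, ← Finset.sum_add_distrib,
        ← Finset.sum_add_distrib]
      refine Finset.sum_congr rfl fun U _ => ?_
      rw [cast_two_pow_sub_two_sub_one]
      ring
    _ = _ := by
      rw [h0, h1, hB]
      linear_combination (1/4 : ℚ) * hT

/-- exact total and average number of embracings over `Π_n`. -/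
theorem emb_mean_over_partitions (n : ℕ) (hn : 1 ≤ n) :
    (∑ π ∈ partitions n, (emb π : ℚ))
        = (1/4) * (bell (n+2) : ℚ) - (5/4) * (bell (n+1) : ℚ)
            + (3/4) * (bell n : ℚ) + ((n : ℚ)/2) * (bell (n-1) : ℚ) ∧
    (∑ π ∈ partitions n, (emb π : ℚ)) / (bell n : ℚ)
        = ((1/4) * (bell (n+2) : ℚ) - (5/4) * (bell (n+1) : ℚ)
            + (3/4) * (bell n : ℚ) + ((n : ℚ)/2) * (bell (n-1) : ℚ)) / (bell n : ℚ) := by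
  exact ⟨sum_emb_partitions n, by rw [sum_emb_partitions n]⟩
end
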